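/- (Sobolev trace theorem for forms.) Let n ≥ 2, 0 ≤ p ≤ n/2 and 1/2 < s < n/2 − p. Then for every Schwartz p-form u on ℝ^n, writing Ru for the pullback of u along ℝ^{n−1} ≅ ℝ^{n−1} × {0} ⊂ ℝ^n, one has ∫_{ℝ^{n−1}} |ξ'|^{2s−1} ‖(Ru)^∧(ξ')‖² dξ' ≤ (Γ(s − 1/2) / (2√π Γ(s))) ∫_{ℝ^n} |ξ|^{2s} ‖û(ξ)‖² dξ. Consequently R extends to a continuous linear map Ḣ^{s,p}(ℝ^n) → Ḣ^{s−1/2,p}(ℝ^{n−1}). -/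

import Mathlib

open MeasureTheory Complex Finset

noncomputable section

/-- Euclidean space ℝ^n -/
abbrev Rn (n : ℕ) := EuclideanSpace ℝ (Fin n)

/-- The full exterior algebra Λ^•ℂ^n, realized as the Euclidean space with orthonormal
basis indexed by subsets of {1,…,n} (the basis e_S = e_{i_1}∧…∧e_{i_p}). -/
abbrev Lam (n : ℕ) := EuclideanSpace ℂ (Finset (Fin n))

variable {n : ℕ}

/-- the sign (-1)^{#{i ∈ S : i < j}} -/
def wsign (j : Fin n) (S : Finset (Fin n)) : ℂ := (-1) ^ (S.filter (· < j)).card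

/-- exterior multiplication ε_x by x ∈ ℂ^n -/
def eps (x : Fin n → ℂ) (v : Lam n) : Lam n :=
  WithLp.toLp 2 fun S => ∑ j ∈ S, wsign j S * x j * v (S.erase j)

/-- interior multiplication i_x by x ∈ ℂ^n (adjoint of ε_x for real x) -/
def iot (x : Fin n → ℂ) (v : Lam n) : Lam n :=
  WithLp.toLp 2 fun S => ∑ j ∈ Sᶜ, wsign j S * x j * v (insert j S)

/-- v lies in the degree-p part Λ^p ℂ^n ⊆ Λ^• ℂ^n -/
def IsForm (p : ℕ) (v : Lam n) : Prop := ∀ S, S.card ≠ p → v S = 0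

/-- complexification of a real vector -/
def rc (x : Fin n → ℝ) : Fin n → ℂ := fun j => (x j : ℂ)

/-- the j-th standard basis vector of ℂ^n -/
def ee (j : Fin n) : Fin n → ℂ := fun i => if i = j then 1 else 0

/-- extend x' ∈ ℝ^{n-1} by last coordinate t to the vector (x',t) ∈ ℝ^n -/
def app (x' : Rn (n-1)) (t : ℝ) : Rn n :=
  WithLp.toLp 2 fun j => if h : (j : ℕ) < n - 1 then x' ⟨j, h⟩ else t

/-- restriction ℝ^n → ℝ^{n-1}, x ↦ x' -/
def restr (ξ : Rn n) : Rn (n-1) := WithLp.toLp 2 fun i => ξ (Fin.castLE (Nat.sub_le n 1) i)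

/-- the embedding Fin (n-1) ↪ Fin n -/
def embF : Fin (n-1) ↪ Fin n := ⟨Fin.castLE (Nat.sub_le n 1), (Fin.castLE_injective _)⟩

/-- pullback Λ^• ℂ^n → Λ^• ℂ^{n-1}; on p-forms this is the projection i_{e_n} ε_{e_n}
followed by restriction of indices. -/
def projL (v : Lam n) : Lam (n-1) := WithLp.toLp 2 fun T => v (T.map embF)

/-- the inclusion Λ^• ℂ^{n-1} ⊆ Λ^• ℂ^n -/
def incL (v : Lam (n-1)) : Lam n :=
  WithLp.toLp 2 fun S => ∑ T : Finset (Fin (n-1)), if T.map embF = S then v T else 0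

/-- the operator i_z ε_z - ε_z i_z -/
def cmm (z : Fin n → ℂ) (v : Lam n) : Lam n := iot z (eps z v) - eps z (iot z v)

/-- partial derivative ∂/∂x_j -/
def pd (j : Fin n) (u : Rn n → Lam n) : Rn n → Lam n :=
  fun x => fderiv ℝ u x (EuclideanSpace.single j 1)

/-- the differential operator Δ_{a,p} = x_n²Δ + a x_n ∂_n + 2x_n(i_{e_n}d' - ε_{e_n}δ')
- (n-2p) ε_{e_n} i_{e_n}; here ℓ is the index of the last coordinate. -/
def Dap (a : ℝ) (p : ℕ) (ℓ : Fin n) (u : Rn n → Lam n) (x : Rn n) : Lam n :=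
  ((x ℓ)^2 : ℝ) • (∑ j, pd j (pd j u) x)
  + (a * x ℓ) • pd ℓ u x
  + (2 * x ℓ) • (iot (ee ℓ) (∑ j ∈ univ.erase ℓ, eps (ee j) (pd j u x))
      - eps (ee ℓ) (-(∑ j ∈ univ.erase ℓ, iot (ee j) (pd j u x))))
  - ((n : ℝ) - 2*p) • eps (ee ℓ) (iot (ee ℓ) (u x))

/-- the formal transpose of Δ_{a,p} with respect to the bilinear pairing
∫ ⟨u(x), φ(x)⟩ dx (⟨·,·⟩ the bilinear form with ⟨e_S, e_T⟩ = δ_{ST}):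
Δ_{a,p}ᵗφ = Δ(x_n²φ) - a ∂_n(x_n φ) - 2x_n Σ_j (i_{e_j}ε_{e_n} + ε_{e_j}i_{e_n}) ∂_j φ
- (n-2p) ε_{e_n} i_{e_n} φ. -/
def DapT (a : ℝ) (p : ℕ) (ℓ : Fin n) (φ : Rn n → Lam n) (x : Rn n) : Lam n :=
  (∑ j, pd j (pd j (fun y => ((y ℓ)^2 : ℝ) • φ y)) x)
  - a • pd ℓ (fun y => (y ℓ) • φ y) x
  - (2 * x ℓ) • (∑ j ∈ univ.erase ℓ,
      (iot (ee j) (eps (ee ℓ) (pd j φ x)) + eps (ee j) (iot (ee ℓ) (pd j φ x))))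
  - ((n : ℝ) - 2*p) • eps (ee ℓ) (iot (ee ℓ) (φ x))

/-- the Fourier transform with the convention û(ξ) = (2π)^{-n/2} ∫ e^{-i x·ξ} u(x) dx -/
def ft (u : Rn n → Lam n) : Rn n → Lam n := fun ξ =>
  ((2 * Real.pi) ^ (-(n:ℝ)/2) : ℝ) •
    ∫ x, Complex.exp (-(((∑ j, x j * ξ j : ℝ) : ℂ) * Complex.I)) • u x

/-- the inverse Fourier transform -/
def ftInv (u : Rn n → Lam n) : Rn n → Lam n := fun ξ =>
  ((2 * Real.pi) ^ (-(n:ℝ)/2) : ℝ) •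
    ∫ x, Complex.exp ((((∑ j, x j * ξ j : ℝ) : ℂ) * Complex.I)) • u x

/-- The homogeneous Sobolev space Ḣ^{s,p}(ℝ^n) of Λ^pℂ^n-valued tempered distributions,
modeled on the Fourier transform side: an element of the set is the function g = û. -/
def Hdot (n : ℕ) (s : ℝ) (p : ℕ) : Set (Rn n → Lam n) :=
  {g | AEStronglyMeasurable g volume ∧ (∀ ξ, IsForm p (g ξ)) ∧
    Integrable (fun ξ => ‖ξ‖ ^ (2*s) * ‖g ξ‖^2)}

/-- squared weighted L² norm ∫ ‖ξ‖^t ‖g(ξ)‖² dξ on the Fourier side;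
wInt (2s) g is the squared homogeneous Sobolev norm of degree s of u with û = g. -/
def wInt (t : ℝ) (g : Rn n → Lam n) : ℝ := ∫ ξ, ‖ξ‖ ^ t * ‖g ξ‖^2

/-- the operator (c - λ) i_x ε_x + (c + λ) ε_x i_x on Λ^•ℂ^n -/
def opC (c lam : ℝ) (x : Fin n → ℝ) (v : Lam n) : Lam n :=
  ((c - lam : ℝ) : ℂ) • iot (rc x) (eps (rc x) v)
    + ((c + lam : ℝ) : ℂ) • eps (rc x) (iot (rc x) v)

/-- the conformally invariant squared norm ‖u‖_λ² on the Fourier side (for û = g);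
c is dim/2 - p, i.e. n/2 - p on ℝ^n and (n-1)/2 - p on ℝ^{n-1}. -/
def cSq (c lam : ℝ) (g : Rn n → Lam n) : ℝ :=
  ∫ ξ, ‖ξ‖ ^ (-(2*lam)) * (inner ℂ (g ξ) (opC c lam (‖ξ‖⁻¹ • ξ) (g ξ)) : ℂ).re

/-- the conformally invariant inner product on the Fourier side -/
def cIp (c lam : ℝ) (g h : Rn n → Lam n) : ℂ :=
  ∫ ξ, (‖ξ‖ ^ (-(2*lam)) : ℝ) • (inner ℂ (g ξ) (opC c lam (‖ξ‖⁻¹ • ξ) (h ξ)) : ℂ)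

/-- the bilinear pairing on Λ^•ℂ^n with ⟨e_S, e_T⟩ = δ_{ST} -/
def blin (v w : Lam n) : ℂ := ∑ S, v S * w S

/-- the pairing ⟨u, ψ⟩ of the tempered distribution u whose Fourier transform is g
with a Schwartz function ψ: ⟨u, ψ⟩ = ⟨û, 𝓕⁻¹ψ⟩ = ∫ ⟨g(ξ), (𝓕⁻¹ψ)(ξ)⟩ dξ. -/
def dpair (g : Rn n → Lam n) (ψ : Rn n → Lam n) : ℂ :=
  ∫ ξ, blin (g ξ) (ftInv ψ ξ)

/-- "Δ_{a,p} u = μ u in the sense of tempered distributions", expressed for the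
distribution u whose Fourier transform is g: testing against all Λ^•ℂ^n-valued
Schwartz functions φ via the formal transpose of Δ_{a,p}. -/
def WeakEig (a : ℝ) (p : ℕ) (ℓ : Fin n) (g : Rn n → Lam n) (μ : ℂ) : Prop :=
  ∀ φ : SchwartzMap (Rn n) (Lam n),
    dpair g (fun x => DapT a p ℓ (fun y => φ y) x - μ • φ x) = 0

/-- the Fourier side of the trace map u ↦ u|_{ℝ^{n-1}}:
(Ru)^(ξ') = (2π)^{-1/2} ∫_ℝ û(ξ', ξ_n) dξ_n, composed with the pullback
Λ^pℂ^n → Λ^pℂ^{n-1}. -/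
def ftrace (g : Rn n → Lam n) : Rn (n-1) → Lam (n-1) := fun ξ' =>
  ((2 * Real.pi) ^ (-(1:ℝ)/2) : ℝ) • ∫ t : ℝ, projL (g (app ξ' t))

/-- the constant c_{a,p} -/
def cP (n p : ℕ) (a : ℝ) : ℝ :=
  2 * Real.Gamma (((n:ℝ) - a + 2)/2) /
    (Real.pi ^ (((n:ℝ)-1)/2) * ((n:ℝ) - 2*p - a) * Real.Gamma ((1-a)/2))

/-- the Poisson transform P_{a,p}f(x) = c_{a,p} ∫_{ℝ^{n-1}} |x_n|^{1-a}
(|x'-y|²+x_n²)^{-(n-a+2)/2} (i_{x-y}ε_{x-y} - ε_{x-y}i_{x-y}) f(y) dy,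
where ℓ is the index of the last coordinate. -/
def Pois (a : ℝ) (p : ℕ) (ℓ : Fin n) (f : Rn (n-1) → Lam (n-1)) (x : Rn n) : Lam n :=
  cP n p a • ∫ y : Rn (n-1),
    (|x ℓ| ^ (1-a) * ‖x - app y 0‖ ^ (-((n:ℝ) - a + 2))) •
      cmm (rc (x - app y 0)) (incL (f y))

/-- "G is the Fourier transform of the (polynomially bounded, locally integrable)
function u in the sense of tempered distributions":
∫ ⟨G(ξ), ψ(ξ)⟩ dξ = ∫ ⟨u(x), ψ̂(x)⟩ dx for every Schwartz function ψ. -/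
def IsFTof (G : Rn n → Lam n) (u : Rn n → Lam n) : Prop :=
  ∀ ψ : SchwartzMap (Rn n) (Lam n),
    ∫ ξ, blin (G ξ) (ψ ξ) = ∫ x, blin (u x) (ft (fun y => ψ y) x)

theorem app_measPres (hn : 1 ≤ n) :
    MeasurePreserving (fun q : Rn (n-1) × ℝ => app (n := n) q.1 q.2)
      (volume.prod volume) volume ∧
    MeasurableEmbedding (fun q : Rn (n-1) × ℝ => app (n := n) q.1 q.2) := by
  obtain ⟨m, rfl⟩ : ∃ m, n = m + 1 := ⟨n - 1, by omega⟩
  let e1 : (Fin m → ℝ) ≃ᵐ Rn m := MeasurableEquiv.toLp 2 (Fin m → ℝ)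
  let e2 : (Fin (m+1) → ℝ) ≃ᵐ Rn (m+1) := MeasurableEquiv.toLp 2 (Fin (m+1) → ℝ)
  let e3 := MeasurableEquiv.piFinSuccAbove (fun _ : Fin (m+1) => ℝ) (Fin.last m)
  have h1 : MeasurePreserving e1.symm volume volume :=
    EuclideanSpace.volume_preserving_symm_measurableEquiv_toLp _
  have h2 : MeasurePreserving e2 volume volume :=
    (EuclideanSpace.volume_preserving_symm_measurableEquiv_toLp (Fin (m+1))).symm
  have h3 : MeasurePreserving e3 volume volume :=
    volume_preserving_piFinSuccAbove (fun _ : Fin (m+1) => ℝ) (Fin.last m)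
  let E : Rn m × ℝ ≃ᵐ Rn (m+1) :=
    ((e1.symm.prodCongr (MeasurableEquiv.refl ℝ)).trans MeasurableEquiv.prodComm).trans
      (e3.symm.trans e2)
  have hE : (fun q : Rn (m+1-1) × ℝ => app (n := m+1) q.1 q.2) = E := by
    funext q
    ext j
    refine Fin.lastCases ?_ (fun i => ?_) j
    · simp [app, E, e1, e2, e3]
      rfl
    · simp [app, E, e1, e2, e3]
      rfl
  rw [hE]
  refine ⟨?_, E.measurableEmbedding⟩
  have hp : MeasurePreserving (e1.symm.prodCongr (MeasurableEquiv.refl ℝ))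
      ((volume : Measure (Rn m)).prod (volume : Measure ℝ)) (volume.prod volume) :=
    h1.prod (MeasurePreserving.id volume)
  have hs : MeasurePreserving (MeasurableEquiv.prodComm : (Fin m → ℝ) × ℝ ≃ᵐ ℝ × (Fin m → ℝ))
      (volume.prod volume) (volume.prod volume) := Measure.measurePreserving_swap
  exact h2.comp (h3.symm.comp (hs.comp hp))

theorem sum_app (hn : 1 ≤ n) (F : ℝ → ℝ → ℝ) (x y : Rn (n-1)) (t r : ℝ) :
    ∑ j, F (app (n := n) x t j) (app (n := n) y r j) = (∑ i, F (x i) (y i)) + F t r := by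
  obtain ⟨m, rfl⟩ : ∃ m, n = m + 1 := ⟨n - 1, by omega⟩
  rw [Fin.sum_univ_castSucc]
  simp [app]

theorem norm_app_sq (hn : 1 ≤ n) (x : Rn (n-1)) (t : ℝ) :
    ‖app (n := n) x t‖ ^ 2 = ‖x‖ ^ 2 + t ^ 2 := by
  rw [EuclideanSpace.norm_sq_eq, EuclideanSpace.norm_sq_eq]
  have := sum_app hn (fun a _ => ‖a‖ ^ 2) x x t t
  simpa using this

theorem norm_app_ge_left (hn : 1 ≤ n) (x : Rn (n-1)) (t : ℝ) : ‖x‖ ≤ ‖app (n := n) x t‖ := by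
  have := norm_app_sq hn x t
  refine (sq_le_sq₀ (norm_nonneg _) (norm_nonneg _)).1 ?_
  nlinarith [sq_nonneg t]

theorem norm_app_ge_right (hn : 1 ≤ n) (x : Rn (n-1)) (t : ℝ) : ‖t‖ ≤ ‖app (n := n) x t‖ := by
  have := norm_app_sq hn x t
  refine (sq_le_sq₀ (norm_nonneg _) (norm_nonneg _)).1 ?_
  rw [Real.norm_eq_abs, sq_abs]
  nlinarith [sq_nonneg ‖x‖]

theorem continuous_app : Continuous (fun q : Rn (n-1) × ℝ => app (n := n) q.1 q.2) := by
  unfold app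
  refine (PiLp.continuous_toLp 2 _).comp (continuous_pi fun j => ?_)
  split_ifs with h
  · fun_prop
  · fun_prop

/-- the pullback as a continuous linear map -/
def projC (n : ℕ) : Lam n →L[ℂ] Lam (n-1) :=
  LinearMap.toContinuousLinearMap
    { toFun := projL
      map_add' := by intro u v; ext S; simp [projL]
      map_smul' := by intro c v; ext S; simp [projL] }

theorem projC_apply (v : Lam n) : projC n v = projL v := rfl

theorem norm_projL_le (v : Lam n) : ‖projL v‖ ≤ ‖v‖ := by
  refine (sq_le_sq₀ (norm_nonneg _) (norm_nonneg _)).1 ?_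
  rw [EuclideanSpace.norm_sq_eq, EuclideanSpace.norm_sq_eq]
  simp only [projL]
  have := Finset.sum_map univ (⟨fun T : Finset (Fin (n-1)) => T.map embF,
    Finset.map_injective _⟩ : Finset (Fin (n-1)) ↪ Finset (Fin n)) (fun S => ‖v S‖^2)
  refine (le_of_eq this.symm).trans ?_
  exact Finset.sum_le_sum_of_subset_of_nonneg (Finset.subset_univ _) (fun _ _ _ => by positivity)

theorem lint_key (s a : ℝ) (hs : 1/2 < s) (ha : 0 < a) :
    ∫⁻ t : ℝ, ENNReal.ofReal ((a + t^2) ^ (-s)) =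
      ENNReal.ofReal (√Real.pi * Real.Gamma (s - 1/2) / Real.Gamma s * a ^ (1/2 - s)) := by
  have hs0 : 0 < s := by linarith
  have hG : 0 < Real.Gamma s := Real.Gamma_pos_of_pos hs0
  have e1 : ∀ t : ℝ, ENNReal.ofReal ((a + t^2) ^ (-s)) = ENNReal.ofReal (Real.Gamma s)⁻¹ *
      ∫⁻ r in Set.Ioi (0:ℝ), ENNReal.ofReal (r ^ (s-1) * Real.exp (-((a + t^2) * r))) := by
    intro t
    have hat : 0 < a + t^2 := by positivity
    have hI := Real.integral_rpow_mul_exp_neg_mul_Ioi hs0 hat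
    rw [← ofReal_integral_eq_lintegral_ofReal, hI, ← ENNReal.ofReal_mul (by positivity)]
    · congr 1
      rw [one_div, Real.inv_rpow hat.le, Real.rpow_neg hat.le]
      field_simp
    · by_contra h
      rw [integral_undef h] at hI
      have : 0 < (1 / (a + t^2)) ^ s * Real.Gamma s := by positivity
      linarith
    · filter_upwards [ae_restrict_mem measurableSet_Ioi] with r hr
      have : (0:ℝ) < r := hr
      simp only [Pi.zero_apply]; positivity
  simp_rw [e1]
  rw [lintegral_const_mul' _ _ ENNReal.ofReal_ne_top]
  rw [lintegral_lintegral_swap]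
  swap
  · apply Measurable.aemeasurable
    apply Measurable.ennreal_ofReal
    fun_prop
  have e2 : ∀ r ∈ Set.Ioi (0:ℝ), ∫⁻ t : ℝ,
      ENNReal.ofReal (r ^ (s-1) * Real.exp (-((a + t^2) * r))) =
      ENNReal.ofReal (√Real.pi) *
        ENNReal.ofReal (r ^ ((s - 1/2) - 1) * Real.exp (-(a * r))) := by
    intro r hr
    have hr : 0 < r := hr
    have h1 : ∀ t : ℝ, r ^ (s-1) * Real.exp (-((a + t^2) * r)) =
        (r ^ (s-1) * Real.exp (-(a*r))) * Real.exp (-r * t^2) := by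
      intro t
      rw [mul_assoc, ← Real.exp_add]; congr 2; ring
    simp_rw [h1]
    rw [← ofReal_integral_eq_lintegral_ofReal ((integrable_exp_neg_mul_sq hr).const_mul _)
      (Filter.Eventually.of_forall fun t => by positivity), integral_const_mul, integral_gaussian,
      ← ENNReal.ofReal_mul (by positivity)]
    congr 1
    rw [Real.sqrt_div Real.pi_pos.le, Real.sqrt_eq_rpow r, show s - 1/2 - 1 = (s-1) - 1/2 by ring,
      Real.rpow_sub hr (s-1)]
    ring
  rw [setLIntegral_congr_fun measurableSet_Ioi e2, lintegral_const_mul' _ _ ENNReal.ofReal_ne_top]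
  have hs' : 0 < s - 1/2 := by linarith
  have hI := Real.integral_rpow_mul_exp_neg_mul_Ioi hs' ha
  have hG' : 0 < Real.Gamma (s-1/2) := Real.Gamma_pos_of_pos hs'
  rw [← ofReal_integral_eq_lintegral_ofReal, hI, ← ENNReal.ofReal_mul (by positivity),
    ← ENNReal.ofReal_mul (by positivity)]
  · congr 1
    rw [one_div, Real.inv_rpow ha.le, ← Real.rpow_neg ha.le, show 1/2 - s = -(s-1/2) by ring]
    field_simp
  · by_contra h
    rw [integral_undef h] at hI
    have : 0 < (1 / a) ^ (s-1/2) * Real.Gamma (s-1/2) := by positivity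
    linarith
  · filter_upwards [ae_restrict_mem measurableSet_Ioi] with r hr
    have : (0:ℝ) < r := hr
    simp only [Pi.zero_apply]; positivity

/-- Cauchy-Schwarz on one fibre -/
theorem fibre_bound (hn : 2 ≤ n) (s : ℝ) (hs : 1/2 < s) (g : Rn n → Lam n) (x : Rn (n-1))
    (hm : AEStronglyMeasurable (fun t => g (app x t)) volume) :
    ENNReal.ofReal (‖x‖ ^ (2*s-1)) * ‖ftrace g x‖ₑ ^ 2 ≤
      ENNReal.ofReal (Real.Gamma (s - 1/2) / (2 * Real.sqrt Real.pi * Real.Gamma s)) *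
        ∫⁻ t : ℝ, ENNReal.ofReal (‖app x t‖ ^ (2*s)) * ‖g (app x t)‖ₑ ^ 2 := by
  have hn1 : 1 ≤ n := by omega
  have hs0 : 0 < s := by linarith
  have hG : 0 < Real.Gamma s := Real.Gamma_pos_of_pos hs0
  have hG' : 0 < Real.Gamma (s-1/2) := Real.Gamma_pos_of_pos (by linarith)
  have hpi := Real.pi_pos
  by_cases hx : x = 0
  · subst hx
    rw [norm_zero, Real.zero_rpow (by linarith)]
    simp
  have hx0 : 0 < ‖x‖ := norm_pos_iff.2 hx
  set J := ∫⁻ t : ℝ, ENNReal.ofReal (‖app x t‖ ^ (2*s)) * ‖g (app x t)‖ₑ ^ 2 with hJ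
  have hpos : ∀ t, 0 < ‖app (n := n) x t‖ := fun t => lt_of_lt_of_le hx0 (norm_app_ge_left hn1 x t)
  have hcont : Continuous fun t => app (n := n) x t :=
    continuous_app.comp (by fun_prop : Continuous fun t : ℝ => (x, t))
  have hK : ∫⁻ t : ℝ, ENNReal.ofReal (‖app (n := n) x t‖ ^ (-s)) ^ 2 =
      ENNReal.ofReal (√Real.pi * Real.Gamma (s - 1/2) / Real.Gamma s * ‖x‖ ^ (1 - 2*s)) := by
    have := lint_key s (‖x‖^2) hs (by positivity)
    rw [← Real.rpow_natCast_mul hx0.le] at this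
    rw [show 1 - 2*s = ((2:ℕ):ℝ) * (1/2 - s) by push_cast; ring, ← this]
    refine lintegral_congr fun t => ?_
    rw [← norm_app_sq hn1, ← ENNReal.ofReal_pow (by positivity), ← Real.rpow_natCast_mul (hpos t).le,
      ← Real.rpow_mul_natCast (hpos t).le]
    congr 2; ring
  have h1 : ‖∫ t : ℝ, projL (g (app x t))‖ₑ ≤
      ∫⁻ t : ℝ, ENNReal.ofReal (‖app (n := n) x t‖ ^ (-s)) *
        (ENNReal.ofReal (‖app (n := n) x t‖ ^ s) * ‖g (app x t)‖ₑ) := by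
    refine (enorm_integral_le_lintegral_enorm _).trans (lintegral_mono fun t => ?_)
    rw [← mul_assoc, ← ENNReal.ofReal_mul (by positivity), ← Real.rpow_add (hpos t)]
    simp only [neg_add_cancel, Real.rpow_zero, ENNReal.ofReal_one, one_mul]
    rw [← ofReal_norm, ← ofReal_norm]
    exact ENNReal.ofReal_le_ofReal (norm_projL_le _)
  have hm1 : AEMeasurable (fun t => ENNReal.ofReal (‖app (n := n) x t‖ ^ (-s))) volume :=
    (Measurable.ennreal_ofReal ((hcont.norm.measurable).pow_const _)).aemeasurable
  have hm2 : AEMeasurable (fun t => ENNReal.ofReal (‖app (n := n) x t‖ ^ s) * ‖g (app x t)‖ₑ)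
      volume :=
    (Measurable.ennreal_ofReal ((hcont.norm.measurable).pow_const _)).aemeasurable.mul hm.enorm
  have h2 := ENNReal.lintegral_mul_le_Lp_mul_Lq volume Real.HolderConjugate.two_two hm1 hm2
  have hJ' : ∫⁻ t : ℝ, (ENNReal.ofReal (‖app (n := n) x t‖ ^ s) * ‖g (app x t)‖ₑ) ^ 2 = J := by
    refine lintegral_congr fun t => ?_
    rw [mul_pow, ← ENNReal.ofReal_pow (by positivity), ← Real.rpow_mul_natCast (hpos t).le]
    congr 3; push_cast; ring
  have h3 : ‖∫ t : ℝ, projL (g (app x t))‖ₑ ^ 2 ≤ ENNReal.ofReal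
      (√Real.pi * Real.Gamma (s - 1/2) / Real.Gamma s * ‖x‖ ^ (1 - 2*s)) * J := by
    have h4 := h1.trans h2
    simp only [ENNReal.rpow_two] at h4
    rw [hK, hJ', ← ENNReal.mul_rpow_of_nonneg _ _ (by norm_num)] at h4
    have h5 := ENNReal.rpow_le_rpow h4 (by norm_num : (0:ℝ) ≤ 2)
    rw [← ENNReal.rpow_mul] at h5
    simpa using h5
  have h6 : ‖ftrace g x‖ₑ ^ 2 = ENNReal.ofReal ((2*Real.pi)⁻¹) *
      ‖∫ t : ℝ, projL (g (app x t))‖ₑ ^ 2 := by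
    unfold ftrace
    rw [enorm_smul, mul_pow]
    congr 1
    rw [Real.enorm_of_nonneg (by positivity), ← ENNReal.ofReal_pow (by positivity),
      ← Real.rpow_mul_natCast (by positivity)]
    congr 1
    norm_num
    rw [Real.rpow_neg_one]; field_simp
  rw [h6]
  calc _ ≤ ENNReal.ofReal (‖x‖ ^ (2*s-1)) * (ENNReal.ofReal ((2*Real.pi)⁻¹) * (ENNReal.ofReal
      (√Real.pi * Real.Gamma (s - 1/2) / Real.Gamma s * ‖x‖ ^ (1 - 2*s)) * J)) := by gcongr
    _ = _ := by
      rw [← mul_assoc, ← mul_assoc, ← ENNReal.ofReal_mul (by positivity),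
        ← ENNReal.ofReal_mul (by positivity)]
      congr 2
      have e : ‖x‖ ^ (2*s-1) * ‖x‖ ^ (1 - 2*s) = 1 := by
        rw [← Real.rpow_add hx0]; simp
      have e2 : √Real.pi * √Real.pi = Real.pi := Real.mul_self_sqrt hpi.le
      have e3 : 0 < √Real.pi := Real.sqrt_pos.2 hpi
      calc _ = (‖x‖ ^ (2*s-1) * ‖x‖ ^ (1 - 2*s)) *
            ((2*Real.pi)⁻¹ * (√Real.pi * Real.Gamma (s - 1/2) / Real.Gamma s)) := by ring
        _ = (2*(√Real.pi * √Real.pi))⁻¹ * (√Real.pi * Real.Gamma (s - 1/2) / Real.Gamma s) := by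
            rw [e, e2, one_mul]
        _ = _ := by field_simp

theorem ofReal_weight {m : ℕ} (x : Rn m) (t : ℝ) (v : Lam m) :
    ENNReal.ofReal (‖x‖ ^ t * ‖v‖ ^ 2) = ENNReal.ofReal (‖x‖ ^ t) * ‖v‖ₑ ^ 2 := by
  rw [ENNReal.ofReal_mul (by positivity), ENNReal.ofReal_pow (norm_nonneg _), ofReal_norm]

theorem isForm_integral {α : Type*} [MeasurableSpace α] {m : ℕ} (μ : Measure α) (p : ℕ)
    (f : α → Lam m) (h : ∀ a, IsForm p (f a)) : IsForm p (∫ a, f a ∂μ) := by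
  intro S hS
  by_cases hf : Integrable f μ
  · have := (EuclideanSpace.proj (𝕜 := ℂ) S).integral_comp_comm hf
    have e : (∫ a, f a ∂μ) S = EuclideanSpace.proj (𝕜 := ℂ) S (∫ a, f a ∂μ) := rfl
    rw [e, ← this]
    simp [h _ S hS]
  · rw [integral_undef hf]; rfl

theorem trace_main (hn : 2 ≤ n) (p : ℕ) (s : ℝ) (hs : 1/2 < s) (g : Rn n → Lam n)
    (hg : g ∈ Hdot n s p) :
      ftrace g ∈ Hdot (n-1) (s - 1/2) p ∧
      wInt (2*s - 1) (ftrace g)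
        ≤ (Real.Gamma (s - 1/2) / (2 * Real.sqrt Real.pi * Real.Gamma s)) * wInt (2*s) g := by
  obtain ⟨gm, gf, gi⟩ := hg
  have hn1 : 1 ≤ n := by omega
  obtain ⟨mp, me⟩ := app_measPres hn1
  have hG : 0 < Real.Gamma s := Real.Gamma_pos_of_pos (by linarith)
  have hG' : 0 < Real.Gamma (s-1/2) := Real.Gamma_pos_of_pos (by linarith)
  set C := Real.Gamma (s - 1/2) / (2 * Real.sqrt Real.pi * Real.Gamma s) with hC
  have hC0 : 0 ≤ C := by have := Real.pi_pos; positivity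
  have gm' : AEStronglyMeasurable (fun q : Rn (n-1) × ℝ => g (app q.1 q.2))
      (volume.prod volume) := gm.comp_measurePreserving mp
  have tm : AEStronglyMeasurable (ftrace g) volume := by
    unfold ftrace
    have h := AEStronglyMeasurable.integral_prod_right'
      (f := fun q : Rn (n-1) × ℝ => projL (g (app q.1 q.2)))
      ((projC n).continuous.comp_aestronglyMeasurable gm')
    exact h.const_smul ((2 * Real.pi) ^ (-(1:ℝ)/2) : ℝ)
  have gi' : Integrable (fun q : Rn (n-1) × ℝ => ‖app q.1 q.2‖ ^ (2*s) * ‖g (app q.1 q.2)‖^2)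
      (volume.prod volume) := (mp.integrable_comp_emb me).2 gi
  have hL : ∫⁻ x, ENNReal.ofReal (‖x‖ ^ (2*s-1)) * ‖ftrace g x‖ₑ ^ 2 ≤
      ENNReal.ofReal (C * wInt (2*s) g) := by
    calc _ ≤ ∫⁻ x : Rn (n-1), ENNReal.ofReal C *
          ∫⁻ t : ℝ, ENNReal.ofReal (‖app x t‖ ^ (2*s)) * ‖g (app x t)‖ₑ ^ 2 := by
          refine lintegral_mono_ae ?_
          filter_upwards [gm'.prodMk_left] with x hx
          exact fibre_bound hn s hs g x hx
      _ = ENNReal.ofReal C * ∫⁻ x : Rn (n-1),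
          ∫⁻ t : ℝ, ENNReal.ofReal (‖app x t‖ ^ (2*s) * ‖g (app x t)‖ ^ 2) := by
          rw [lintegral_const_mul' _ _ ENNReal.ofReal_ne_top]
          simp_rw [ofReal_weight]
      _ = ENNReal.ofReal C * ∫⁻ q : Rn (n-1) × ℝ,
          ENNReal.ofReal (‖app q.1 q.2‖ ^ (2*s) * ‖g (app q.1 q.2)‖ ^ 2) ∂(volume.prod volume) := by
          rw [lintegral_prod _ gi'.aestronglyMeasurable.aemeasurable.ennreal_ofReal]
      _ = _ := by
          rw [mp.lintegral_comp_emb me (fun ξ => ENNReal.ofReal (‖ξ‖ ^ (2*s) * ‖g ξ‖ ^ 2)),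
            ENNReal.ofReal_mul hC0]
          congr 1
          rw [wInt, ofReal_integral_eq_lintegral_ofReal gi
            (Filter.Eventually.of_forall fun t => by positivity)]
  have hW : 0 ≤ C * wInt (2*s) g :=
    mul_nonneg hC0 (integral_nonneg fun t => by positivity)
  have hmeas : AEStronglyMeasurable (fun x => ‖x‖ ^ (2*s-1) * ‖ftrace g x‖ ^ 2) volume :=
    ((measurable_norm.pow_const _).aestronglyMeasurable).mul (tm.norm.pow 2)
  refine ⟨⟨tm, ?_, ?_⟩, ?_⟩
  · intro x S hS
    have : IsForm p (∫ t : ℝ, projL (g (app x t))) := by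
      refine isForm_integral _ _ _ fun t T hT => ?_
      exact gf _ _ (by simpa using hT)
    simp [ftrace, this S hS]
  · rw [show 2 * (s - 1/2) = 2*s-1 by ring]
    refine ⟨hmeas, ?_⟩
    rw [hasFiniteIntegral_iff_ofReal (Filter.Eventually.of_forall fun t => by positivity)]
    simp_rw [ofReal_weight]
    exact hL.trans_lt ENNReal.ofReal_lt_top
  · rw [wInt, integral_eq_lintegral_of_nonneg_ae
      (Filter.Eventually.of_forall fun t => by positivity) hmeas]
    simp_rw [ofReal_weight]
    exact ENNReal.toReal_le_of_le_ofReal hW hL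

open FourierTransform in
theorem ft_eq_fourier {m : ℕ} (f : Rn m → Lam m) (ξ : Rn m) :
    ft f ξ = ((2 * Real.pi) ^ (-(m:ℝ)/2) : ℝ) • 𝓕 f ((2*Real.pi)⁻¹ • ξ) := by
  unfold ft
  rw [Real.fourier_eq']
  congr 2
  funext x
  congr 2
  rw [inner_smul_right, PiLp.inner_apply]
  have : ∑ i, inner ℝ (x i) (ξ i) = ∑ j, x j * ξ j := by
    refine Finset.sum_congr rfl fun i _ => ?_
    simp [mul_comm]
  rw [this, ← neg_mul, ← ofReal_neg]
  congr 2
  have := Real.pi_pos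
  field_simp

open FourierTransform in
theorem ft_schwartz {m : ℕ} (u : SchwartzMap (Rn m) (Lam m)) :
    ∃ U : SchwartzMap (Rn m) (Lam m), ∀ ξ, U ξ = ft (fun x => u x) ξ := by
  have h2 : (2*Real.pi)⁻¹ ≠ 0 := by have := Real.pi_pos; positivity
  let e : Rn m ≃L[ℝ] Rn m := ContinuousLinearEquiv.smulLeft (Units.mk0 _ h2)
  refine ⟨((2 * Real.pi) ^ (-(m:ℝ)/2) : ℝ) •
    (SchwartzMap.compCLMOfContinuousLinearEquiv ℝ e (𝓕 u)), fun ξ => ?_⟩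
  rw [ft_eq_fourier, _root_.smul_apply, SchwartzMap.compCLMOfContinuousLinearEquiv_apply]
  congr 1

theorem schwartz_decay {m : ℕ} (u : SchwartzMap (Rn m) (Lam m)) (k : ℕ) :
    ∃ C : ℝ, 0 ≤ C ∧ ∀ x, (1 + ‖x‖) ^ k * ‖u x‖ ≤ C := by
  have := fun x => SchwartzMap.one_add_le_sup_seminorm_apply (𝕜 := ℝ) (m := (k, 0)) le_rfl le_rfl u x
  simp only [norm_iteratedFDeriv_zero] at this
  exact ⟨_, le_trans (by positivity) (this 0), this⟩

theorem schwartz_decay' {m : ℕ} (u : SchwartzMap (Rn m) (Lam m)) (k : ℕ) :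
    ∃ C : ℝ, 0 ≤ C ∧ ∀ x, ∀ r : ℝ, 0 ≤ r → r ≤ ‖x‖ → ‖u x‖ ≤ C * (1 + r) ^ (-(k:ℝ)) := by
  obtain ⟨C, hC, h⟩ := schwartz_decay u k
  refine ⟨C, hC, fun x r hr hrx => ?_⟩
  rw [Real.rpow_neg (by positivity), Real.rpow_natCast, ← div_eq_mul_inv, le_div_iff₀ (by positivity),
    mul_comm]
  refine le_trans ?_ (h x)
  gcongr

theorem schwartz_mem_Hdot {m : ℕ} (u : SchwartzMap (Rn m) (Lam m)) (p : ℕ) (s : ℝ) (hs : 0 < s)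
    (hu : ∀ x, IsForm p (u x)) : ft (fun x => u x) ∈ Hdot m s p := by
  obtain ⟨U, hU⟩ := ft_schwartz u
  have hU' : ft (fun x => u x) = fun ξ => U ξ := funext fun ξ => (hU ξ).symm
  refine ⟨?_, ?_, ?_⟩
  · rw [hU']; exact U.continuous.aestronglyMeasurable
  · intro ξ S hS
    have : IsForm p (∫ x, Complex.exp (-(((∑ j, x j * ξ j : ℝ) : ℂ) * Complex.I)) • u x) := by
      refine isForm_integral _ _ _ fun x T hT => ?_
      simp [hu x T hT]
    unfold ft
    rw [PiLp.smul_apply, this S hS, smul_zero]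
  · rw [hU']
    obtain ⟨k, hk⟩ := exists_nat_ge (2*s)
    obtain ⟨C, hC, h⟩ := schwartz_decay U k
    refine Integrable.mono' ((U.integrable (μ := volume)).norm.const_mul C) ?_
      (Filter.Eventually.of_forall fun ξ => ?_)
    · exact ((measurable_norm.pow_const _).aestronglyMeasurable).mul
        (U.continuous.aestronglyMeasurable.norm.pow 2)
    · rw [Real.norm_of_nonneg (by positivity), sq, ← mul_assoc]
      refine mul_le_mul_of_nonneg_right (le_trans ?_ (h ξ)) (norm_nonneg _)
      refine mul_le_mul_of_nonneg_right ?_ (norm_nonneg _)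
      calc ‖ξ‖ ^ (2*s) ≤ (1 + ‖ξ‖) ^ (2*s) := by
            apply Real.rpow_le_rpow <;> first | positivity | linarith
        _ ≤ (1 + ‖ξ‖) ^ (k:ℝ) := Real.rpow_le_rpow_of_exponent_le (by simp) hk
        _ = _ := Real.rpow_natCast _ _

open FourierTransform in
theorem slice (hn : 2 ≤ n) (u : SchwartzMap (Rn n) (Lam n)) (ξ' : Rn (n-1)) :
    ft (fun x' : Rn (n-1) => projL (u (app x' 0))) ξ' = ftrace (ft (fun x => u x)) ξ' := by
  have hn1 : 1 ≤ n := by omega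
  obtain ⟨mp, me⟩ := app_measPres hn1
  have hpi := Real.pi_pos
  let e : Rn (n-1) → ℂ := fun x' => Complex.exp (-(((∑ j, x' j * ξ' j : ℝ) : ℂ) * Complex.I))
  have he : Continuous e := by unfold e; fun_prop
  have he1 : ∀ x, ‖e x‖ = 1 := by
    intro x
    have : e x = Complex.exp (((-(∑ j, x j * ξ' j) : ℝ) : ℂ) * Complex.I) := by
      simp only [e]; congr 1; push_cast; ring
    rw [this, Complex.norm_exp_ofReal_mul_I]
  let v : ℝ → Lam n := fun y => ∫ x' : Rn (n-1), e x' • u (app x' y)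
  have hui : Integrable (fun q : Rn (n-1) × ℝ => u (app q.1 q.2)) (volume.prod volume) :=
    (mp.integrable_comp_emb me).2 (u.integrable (μ := volume))
  have hF : Integrable (fun q : Rn (n-1) × ℝ => e q.1 • u (app q.1 q.2)) (volume.prod volume) := by
    refine hui.mono ?_ (Filter.Eventually.of_forall fun q => ?_)
    · exact ((he.comp continuous_fst).smul (u.continuous.comp continuous_app)).aestronglyMeasurable
    · rw [norm_smul, he1, one_mul]
  have hvi : Integrable v volume := hF.integral_prod_right
  obtain ⟨C, hC, hdec⟩ := schwartz_decay' u n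
  have hint : Integrable (fun x' : Rn (n-1) => C * (1 + ‖x'‖) ^ (-(n:ℝ))) volume := by
    refine (integrable_one_add_norm ?_).const_mul C
    simp only [finrank_euclideanSpace, Fintype.card_fin]
    exact_mod_cast (by omega : n - 1 < n)
  have hbd : ∀ (y : ℝ) (x' : Rn (n-1)), ‖e x' • u (app x' y)‖ ≤ C * (1 + ‖x'‖) ^ (-(n:ℝ)) := by
    intro y x'
    rw [norm_smul, he1, one_mul]
    exact hdec _ _ (norm_nonneg _) (norm_app_ge_left hn1 x' y)
  have hc2 : ∀ y : ℝ, Continuous fun x' : Rn (n-1) => e x' • u (app x' y) := fun y =>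
    he.smul (u.continuous.comp (continuous_app.comp (by fun_prop : Continuous fun x' => (x', y))))
  have hvc : Continuous v := by
    refine continuous_of_dominated (bound := fun x' => C * (1 + ‖x'‖) ^ (-(n:ℝ)))
      (fun y => (hc2 y).aestronglyMeasurable)
      (fun y => Filter.Eventually.of_forall (hbd y)) hint (Filter.Eventually.of_forall fun x' => ?_)
    exact (continuous_const (y := e x')).smul
      (u.continuous.comp (continuous_app.comp (by fun_prop : Continuous fun y => (x', y))))
  have hft : ∀ t : ℝ, ft (fun x => u x) (app ξ' t) =
      ((2 * Real.pi) ^ (-(n:ℝ)/2) : ℝ) • 𝓕 v (t / (2*Real.pi)) := by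
    intro t
    unfold ft
    congr 1
    rw [← mp.integral_comp me, Real.fourier_real_eq_integral_exp_smul]
    have e1 : ∀ q : Rn (n-1) × ℝ,
        Complex.exp (-(((∑ j, app (n := n) q.1 q.2 j * app (n := n) ξ' t j : ℝ) : ℂ) * Complex.I)) •
          u (app q.1 q.2) =
        Complex.exp (↑(-2 * Real.pi * q.2 * (t / (2*Real.pi))) * Complex.I) •
          (e q.1 • u (app q.1 q.2)) := by
      intro q
      rw [sum_app hn1 (fun a b => a * b), smul_smul]
      congr 1
      simp only [e]
      rw [← Complex.exp_add]
      congr 1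
      rw [show -2 * Real.pi * q.2 * (t / (2*Real.pi)) = -(q.2 * t) by field_simp]
      push_cast
      ring
    simp_rw [e1]
    rw [integral_prod_symm]
    · refine integral_congr_ae (Filter.Eventually.of_forall fun y => ?_)
      exact integral_smul (Complex.exp (↑(-2 * Real.pi * y * (t / (2*Real.pi))) * Complex.I))
        (fun x' : Rn (n-1) => e x' • u (app x' y))
    · refine hF.mono ?_ (Filter.Eventually.of_forall fun q => ?_)
      · have hcc : Continuous fun q : Rn (n-1) × ℝ =>
            Complex.exp (↑(-2 * Real.pi * q.2 * (t / (2*Real.pi))) * Complex.I) := by fun_prop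
        exact Continuous.aestronglyMeasurable (hcc.smul
          ((he.comp continuous_fst).smul (u.continuous.comp continuous_app)))
      · rw [norm_smul, Complex.norm_exp_ofReal_mul_I, one_mul]
  have hc0 : (0:ℝ) < (2 * Real.pi) ^ (-(n:ℝ)/2) := by positivity
  have hline : Integrable (fun t : ℝ => ft (fun x => u x) (app ξ' t)) volume := by
    obtain ⟨U, hU⟩ := ft_schwartz u
    simp_rw [← hU]
    obtain ⟨C', hC', hdec'⟩ := schwartz_decay' U 2
    have hi : Integrable (fun t : ℝ => C' * (1 + ‖t‖) ^ (-((2:ℕ):ℝ))) volume := by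
      refine (integrable_one_add_norm ?_).const_mul C'
      simp
    refine hi.mono' ?_ (Filter.Eventually.of_forall fun t => ?_)
    · exact (U.continuous.comp (continuous_app.comp
        (by fun_prop : Continuous fun t => (ξ', t)))).aestronglyMeasurable
    · exact hdec' _ _ (norm_nonneg _) (norm_app_ge_right hn1 ξ' t)
  have hFi' : Integrable (fun t : ℝ => 𝓕 v (t / (2*Real.pi))) volume := by
    simp_rw [hft] at hline
    exact (integrable_smul_iff hc0.ne' _).1 hline
  have hFi : Integrable (𝓕 v) volume := (integrable_comp_div_iff _ (by positivity)).1 hFi'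
  have hinv : v 0 = ∫ w, 𝓕 v w := by
    have := congrFun (hvc.fourierInv_fourier_eq hvi hFi) 0
    rw [← this, Real.fourierInv_eq']
    simp
  have hR : ∫ t : ℝ, projL (ft (fun x => u x) (app ξ' t)) =
      ((2 * Real.pi) ^ (-(n:ℝ)/2) * (2 * Real.pi) : ℝ) • projL (v 0) := by
    have h1 := (projC n).integral_comp_comm hline
    simp only [projC_apply] at h1
    rw [h1, ← projC_apply, ← projC_apply]
    simp_rw [hft]
    rw [integral_smul, Measure.integral_comp_div, ← hinv, abs_of_pos (by positivity), smul_smul]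
    exact ((projC n).restrictScalars ℝ).map_smul _ _
  have hv0 : ∫ x' : Rn (n-1), e x' • projL (u (app x' 0)) = projL (v 0) := by
    have hi0 : Integrable (fun x' : Rn (n-1) => e x' • u (app x' 0)) volume :=
      hint.mono' (hc2 0).aestronglyMeasurable (Filter.Eventually.of_forall (hbd 0))
    have h1 := (projC n).integral_comp_comm hi0
    simp only [map_smul] at h1
    exact h1
  unfold ftrace
  rw [hR, smul_smul]
  unfold ft
  rw [hv0]
  congr 1
  rw [Nat.cast_sub hn1, ← Real.rpow_add_one (by positivity), ← Real.rpow_add (by positivity)]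
  congr 1
  push_cast
  ring

/-- Sobolev trace theorem for forms. For Schwartz p-forms u on ℝ^n and
Ru the pullback to ℝ^{n-1}:
∫ |ξ'|^{2s-1} ‖(Ru)^(ξ')‖² dξ' ≤ (Γ(s-1/2)/(2√π Γ(s))) ∫ |ξ|^{2s} ‖û(ξ)‖² dξ;
consequently R extends to a continuous linear map Ḣ^{s,p}(ℝ^n) → Ḣ^{s-1/2,p}(ℝ^{n-1})
(expressed on the Fourier side, where the extension is given by
g ↦ (ξ' ↦ (2π)^{-1/2} ∫ proj (g(ξ',t)) dt), agreeing with R on Schwartz forms). -/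
theorem stmt3 (n p : ℕ) (hn : 2 ≤ n) (hp : 2*p ≤ n)
    (s : ℝ) (hs1 : 1/2 < s) (hs2 : s < (n:ℝ)/2 - p) :
    -- the trace inequality for Schwartz p-forms
    (∀ u : SchwartzMap (Rn n) (Lam n), (∀ x, IsForm p (u x)) →
      (∫ ξ' : Rn (n-1), ‖ξ'‖ ^ (2*s - 1) * ‖ft (fun x' : Rn (n-1) => projL (u (app x' 0))) ξ'‖^2)
        ≤ (Real.Gamma (s - 1/2) / (2 * Real.sqrt Real.pi * Real.Gamma s)) *
            ∫ ξ : Rn n, ‖ξ‖ ^ (2*s) * ‖ft (fun x => u x) ξ‖^2) ∧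
    -- the Fourier transform of the restriction of a Schwartz form is given by ftrace
    (∀ u : SchwartzMap (Rn n) (Lam n), (∀ x, IsForm p (u x)) → ∀ ξ' : Rn (n-1),
      ft (fun x' : Rn (n-1) => projL (u (app x' 0))) ξ' = ftrace (ft (fun x => u x)) ξ') ∧
    -- consequently the trace extends to a continuous map of homogeneous Sobolev spaces
    (∀ g ∈ Hdot n s p,
      ftrace g ∈ Hdot (n-1) (s - 1/2) p ∧
      wInt (2*s - 1) (ftrace g)
        ≤ (Real.Gamma (s - 1/2) / (2 * Real.sqrt Real.pi * Real.Gamma s)) * wInt (2*s) g) := by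
  refine ⟨fun u hu => ?_, fun u _ ξ => slice hn u ξ, fun g hg => trace_main hn p s hs1 g hg⟩
  have h := (trace_main hn p s hs1 _ (schwartz_mem_Hdot u p s (by linarith) hu)).2
  unfold wInt at h
  simp_rw [slice hn u]
  exact h
end
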